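/- Let p be a prime, d ≥ 1, and let Γ ≤ GL_d(ℤ/pℤ) be the group of upper triangular unipotent Toeplitz matrices, acting on row vectors of (ℤ/pℤ)^d by x ↦ x·A^{−t} (right multiplication by the inverse transpose). Then for each 1 ≤ i ≤ d and α ∈ (ℤ/pℤ)ˣ, the orbit of the vector with α in position i and zeros elsewhere is exactly {x ∈ (ℤ/pℤ)^d : x_i = α, and x_j = 0 for all j > i}, which has size p^{i−1}. -/

import Mathlib

open Matrix

/-- The upper shift matrix `N` with `N_{i,i+1} = 1` and all other entries `0`. -/
def shiftN (p d : ℕ) : Matrix (Fin d) (Fin d) (ZMod p) :=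
  Matrix.of fun i j => if (i : ℕ) + 1 = (j : ℕ) then 1 else 0

theorem shiftN_pow_apply (p d k : ℕ) (i j : Fin d) :
    (shiftN p d ^ k) i j = if (i : ℕ) + k = (j : ℕ) then 1 else 0 := by
  induction k generalizing i with
  | zero => simp [Matrix.one_apply, Fin.ext_iff]
  | succ k ih =>
    rw [pow_succ', Matrix.mul_apply]
    simp only [ih]
    by_cases h : (i : ℕ) + 1 < d
    · rw [Finset.sum_eq_single ⟨i + 1, h⟩]
      · simp [shiftN, add_assoc, add_comm 1 k]
      · intro b _ hb
        rw [shiftN, Matrix.of_apply, if_neg (fun h' => hb (Fin.ext h'.symm)), zero_mul]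
      · simp
    · rw [if_neg (by omega)]
      refine Finset.sum_eq_zero fun b _ => ?_
      rw [shiftN, Matrix.of_apply, if_neg (by omega), zero_mul]

/-- Extension of a vector by zeros to all natural indices. -/
def zeroExtend {R : Type*} [Zero R] {d : ℕ} (z : Fin d → R) (n : ℕ) : R :=
  if h : n < d then z ⟨n, h⟩ else 0

theorem zeroExtend_coe {R : Type*} [Zero R] {d : ℕ} (z : Fin d → R) (j : Fin d) :
    zeroExtend z j = z j := by
  simp [zeroExtend]

theorem shiftN_pow_mulVec (p d k : ℕ) (z : Fin d → ZMod p) (m : Fin d) :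
    (shiftN p d ^ k *ᵥ z) m = zeroExtend z (m + k) := by
  simp only [Matrix.mulVec, dotProduct, shiftN_pow_apply, zeroExtend]
  split_ifs with h
  · rw [Finset.sum_eq_single ⟨m + k, h⟩]
    · simp
    · intro b _ hb
      rw [if_neg (fun h' => hb (Fin.ext h'.symm)), zero_mul]
    · simp
  · refine Finset.sum_eq_zero fun b _ => ?_
    rw [if_neg (by omega), zero_mul]

theorem toeplitz_mulVec (p d : ℕ) (a : ℕ → ZMod p) (z : Fin d → ZMod p) (m : Fin d) :
    ((1 + ∑ k ∈ Finset.Ico 1 d, a (k + 1) • shiftN p d ^ k) *ᵥ z) m =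
      z m + ∑ k ∈ Finset.Ico 1 d, a (k + 1) * zeroExtend z (m + k) := by
  simp [Matrix.add_mulVec, Matrix.sum_mulVec, Matrix.smul_mulVec, shiftN_pow_mulVec]

theorem toeplitz_det (p d : ℕ) (a : ℕ → ZMod p) :
    (1 + ∑ k ∈ Finset.Ico 1 d, a (k + 1) • shiftN p d ^ k).det = 1 := by
  rw [Matrix.det_of_isUpperTriangular]
  · refine Finset.prod_eq_one fun i _ => ?_
    rw [Matrix.add_apply, Matrix.sum_apply, Matrix.one_apply_eq, add_eq_left]
    refine Finset.sum_eq_zero fun k hk => ?_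
    have := Finset.mem_Ico.1 hk
    rw [Matrix.smul_apply, shiftN_pow_apply, if_neg (by omega), smul_zero]
  · intro i j hij
    have hij' : (j : ℕ) < i := hij
    rw [Matrix.add_apply, Matrix.sum_apply, Matrix.one_apply_ne (Fin.ne_of_gt hij'), zero_add]
    refine Finset.sum_eq_zero fun k _ => ?_
    rw [Matrix.smul_apply, shiftN_pow_apply, if_neg (by omega), smul_zero]

theorem eq_vecMul_transpose_inv_iff {n R : Type*} [Fintype n] [DecidableEq n] [CommRing R]
    {A : Matrix n n R} (hA : IsUnit A.det) (x z : n → R) :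
    z = x ᵥ* (Aᵀ)⁻¹ ↔ A *ᵥ z = x := by
  have hA' : IsUnit (Aᵀ).det := by rwa [Matrix.det_transpose]
  rw [← Matrix.vecMul_transpose]
  constructor
  · rintro rfl
    rw [Matrix.vecMul_vecMul, Matrix.nonsing_inv_mul _ hA', Matrix.vecMul_one]
  · rintro rfl
    rw [Matrix.vecMul_vecMul, Matrix.mul_nonsing_inv _ hA', Matrix.vecMul_one]

theorem eq_of_toeplitz_mulVec_eq {p d : ℕ} {a : ℕ → ZMod p} {z : Fin d → ZMod p} {i : Fin d}
    {α : ZMod p}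
    (h : (1 + ∑ k ∈ Finset.Ico 1 d, a (k + 1) • shiftN p d ^ k) *ᵥ z =
      fun j => if j = i then α else 0) :
    z i = α ∧ ∀ j, i < j → z j = 0 := by
  have key : ∀ m : Fin d, z m + ∑ k ∈ Finset.Ico 1 d, a (k + 1) * zeroExtend z (m + k) =
      if m = i then α else 0 := fun m => by rw [← toeplitz_mulVec, h]
  have step : ∀ m : Fin d, (∀ j, m < j → z j = 0) → z m = if m = i then α else 0 := by
    intro m hm
    rw [← key m, left_eq_add]
    refine Finset.sum_eq_zero fun k hk => ?_
    have := Finset.mem_Ico.1 hk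
    rw [zeroExtend]
    split_ifs with hlt
    · rw [hm _ (Fin.lt_def.2 (by simp; omega)), mul_zero]
    · rw [mul_zero]
  have hz : ∀ j, i < j → z j = 0 := by
    intro j
    induction j using WellFoundedGT.induction with
    | ind j ih =>
      intro hj
      rw [step j fun l hl => ih l hl (hj.trans hl), if_neg hj.ne']
  exact ⟨by rw [step i hz, if_pos rfl], hz⟩

theorem exists_toeplitz_mulVec_eq {p d : ℕ} [Fact p.Prime] {z : Fin d → ZMod p} {i : Fin d}
    (hi : z i ≠ 0) (hz : ∀ j, i < j → z j = 0) :
    ∃ a : ℕ → ZMod p, (1 + ∑ k ∈ Finset.Ico 1 d, a (k + 1) • shiftN p d ^ k) *ᵥ z =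
      fun j => if j = i then z i else 0 := by
  let u : PowerSeries (ZMod p) :=
    PowerSeries.mk fun n => if n ≤ i then zeroExtend z (i - n) else 0
  have hu : PowerSeries.constantCoeff u = z i := by
    simp [u, ← PowerSeries.coeff_zero_eq_constantCoeff_apply, zeroExtend_coe]
  let v : PowerSeries (ZMod p) := PowerSeries.C (z i) * u⁻¹
  have hv0 : PowerSeries.coeff 0 v = 1 := by
    simp [v, hu, hi]
  have hvu : v * u = PowerSeries.C (z i) := by
    rw [mul_assoc, PowerSeries.inv_mul_cancel u (by rwa [hu]), mul_one]
  have hz' : ∀ n, (i : ℕ) < n → zeroExtend z n = 0 := by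
    intro n hn
    rw [zeroExtend]
    split_ifs with h
    · exact hz _ hn
    · rfl
  refine ⟨fun k => PowerSeries.coeff (k - 1) v, funext fun m => ?_⟩
  rw [toeplitz_mulVec p d fun k => PowerSeries.coeff (k - 1) v]
  have hsum : z m + ∑ k ∈ Finset.Ico 1 d,
      PowerSeries.coeff (k + 1 - 1) v * zeroExtend z (m + k) =
      ∑ k ∈ Finset.range d, PowerSeries.coeff k v * zeroExtend z (m + k) := by
    rw [Finset.range_eq_Ico, Finset.sum_eq_sum_Ico_succ_bot m.pos, hv0]
    simp [zeroExtend_coe]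
  rw [hsum]
  rcases lt_or_ge i m with him | hmi
  · rw [if_neg him.ne']
    refine Finset.sum_eq_zero fun k _ => ?_
    rw [hz' _ (by omega), mul_zero]
  · have hmi' : (m : ℕ) ≤ i := hmi
    have hc := congrArg (PowerSeries.coeff (i - m : ℕ)) hvu
    rw [PowerSeries.coeff_mul, Finset.Nat.sum_antidiagonal_eq_sum_range_succ_mk,
      PowerSeries.coeff_C] at hc
    have hcond : ((i : ℕ) - m = 0) ↔ m = i := by
      rw [Fin.ext_iff]; omega
    simp only [hcond] at hc
    rw [← hc]
    symm
    have hsub : Finset.range ((i : ℕ) - m).succ ⊆ Finset.range d :=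
      Finset.range_subset_range.2 (by omega)
    rw [← Finset.sum_subset hsub]
    · refine Finset.sum_congr rfl fun k hk => ?_
      have := Finset.mem_range.1 hk
      simp only [u, PowerSeries.coeff_mk]
      rw [if_pos (by omega)]
      congr 2
      omega
    · intro k _ hk
      rw [Finset.mem_range] at hk
      rw [hz' _ (by omega), mul_zero]

theorem ncard_setOf_apply_eq_and_eq_zero {R : Type*} [Fintype R] [Zero R] {d : ℕ} (i : Fin d)
    (α : R) :
    ({x : Fin d → R | x i = α ∧ ∀ j, i < j → x j = 0}).ncard = Fintype.card R ^ (i : ℕ) := by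
  classical
  have hset : {x : Fin d → R | x i = α ∧ ∀ j, i < j → x j = 0} =
      (Fintype.piFinset fun j : Fin d =>
        if j < i then Finset.univ else {if j = i then α else 0} : Finset (Fin d → R)) := by
    ext x
    simp only [Set.mem_ofPred_eq, Finset.mem_coe, Fintype.mem_piFinset]
    constructor
    · rintro ⟨h1, h2⟩ j
      rcases lt_trichotomy j i with h | rfl | h
      · simp [h]
      · simp [h1]
      · simp [h.not_gt, h.ne', h2 j h]
    · intro h
      refine ⟨by simpa using h i, fun j hj => ?_⟩
      simpa [hj.not_gt, hj.ne'] using h j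
  rw [hset, Set.ncard_coe_finset, Fintype.card_piFinset]
  have hcard : ∀ j : Fin d, (if j < i then Finset.univ else {if j = i then α else 0} :
      Finset R).card = if j < i then Fintype.card R else 1 := fun j => by
    by_cases h : j < i <;> simp [h]
  rw [Finset.prod_congr rfl fun j _ => hcard j, Finset.prod_ite, Finset.prod_const_one, mul_one, Finset.prod_const,
    show Finset.univ.filter (fun j => j < i) = Finset.Iio i by ext; simp, Fin.card_Iio]

/-- For the group `Γ` of upper triangular unipotent Toeplitz matrices acting on row
vectors of `(ℤ/pℤ)^d` by `x ↦ x·A⁻ᵗ`, the orbit of the vector with a unit `α` in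
position `i` and zeros elsewhere is `{x : x_i = α, x_j = 0 for j > i}`, of size
`p^i` (`0`-indexed, i.e. `p^{i-1}` in `1`-indexed notation). -/
theorem stmt18 (p : ℕ) [Fact p.Prime] (d : ℕ) (hd : 0 < d)
    (Γ : Set (Matrix (Fin d) (Fin d) (ZMod p)))
    (hΓ : Γ = {A | ∃ a : ℕ → ZMod p,
      A = 1 + ∑ k ∈ Finset.Ico 1 d, a (k + 1) • shiftN p d ^ k})
    (orb : (Fin d → ZMod p) → Set (Fin d → ZMod p))
    (horb : ∀ x, orb x = {z | ∃ A ∈ Γ, z = Matrix.vecMul x (Aᵀ)⁻¹})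
    (i : Fin d) (α : (ZMod p)ˣ) :
    orb (fun j => if j = i then (α : ZMod p) else 0) =
      {x | x i = (α : ZMod p) ∧ ∀ j, i < j → x j = 0} ∧
    ({x : Fin d → ZMod p | x i = (α : ZMod p) ∧ ∀ j, i < j → x j = 0}).ncard =
      p ^ (i : ℕ) := by
  refine ⟨?_, by rw [ncard_setOf_apply_eq_and_eq_zero, ZMod.card]⟩
  ext z
  rw [horb, hΓ]
  constructor
  · rintro ⟨_, ⟨a, rfl⟩, hz⟩
    rw [eq_vecMul_transpose_inv_iff (by rw [toeplitz_det]; exact isUnit_one)] at hz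
    exact eq_of_toeplitz_mulVec_eq hz
  · rintro ⟨hi, hz⟩
    obtain ⟨a, ha⟩ := exists_toeplitz_mulVec_eq (hi ▸ α.ne_zero) hz
    refine ⟨_, ⟨a, rfl⟩, ?_⟩
    rw [eq_vecMul_transpose_inv_iff (by rw [toeplitz_det]; exact isUnit_one), ha, hi]
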